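/- Let C be an [n,k]_q maximum weight spectrum code. If a and b are nonzero codewords of C with V(a) = V(b), then a = λb for some λ ∈ F_q \ {0}. -/

import Mathlib

/-- The Hamming weight of a vector: the number of nonzero coordinates. -/
def wt {ι F : Type*} [Fintype ι] [Zero F] [DecidableEq F] (c : ι → F) : ℕ :=
  (Finset.univ.filter fun i => c i ≠ 0).card

/-- The weight set of a code: the set of nonzero weights of nonzero codewords. -/
def wtSet {ι F : Type*} [Fintype ι] [Zero F] [DecidableEq F] (C : Set (ι → F)) : Set ℕ :=
  {w | ∃ c ∈ C, c ≠ 0 ∧ wt c = w}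

/-- `cnt c β` is the number of coordinates of `c` equal to `β` (denoted `c[β]`). -/
def cnt {ι F : Type*} [Fintype ι] [DecidableEq F] (c : ι → F) (β : F) : ℕ :=
  (Finset.univ.filter fun i => c i = β).card

theorem wt_smul {ι F : Type*} [Fintype ι] [MonoidWithZero F] [NoZeroDivisors F] [DecidableEq F]
    {r : F} (hr : r ≠ 0) (c : ι → F) : wt (r • c) = wt c := by
  simp [wt, hr]

theorem cnt_zero_add_wt {ι F : Type*} [Fintype ι] [Zero F] [DecidableEq F] (c : ι → F) :
    cnt c 0 + wt c = Fintype.card ι :=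
  Finset.card_filter_add_card_filter_not _

/-- The weight of a representative of a point of the projective space of a code is that of any
nonzero vector spanning the point. -/
theorem wt_rep_mk {ι F : Type*} [Fintype ι] [Field F] [DecidableEq F] {C : Submodule F (ι → F)}
    (c : C) (hc : c ≠ 0) : wt ((Projectivization.mk F c hc).rep : ι → F) = wt (c : ι → F) := by
  obtain ⟨u, hu⟩ := Projectivization.exists_smul_eq_mk_rep F c hc
  rw [← hu]
  exact wt_smul u.ne_zero _

/-- If `C` is an `[n,k]_q` maximum weight spectrum code and `a, b` are nonzero codewords
with equal entries-distribution vectors `V(a) = V(b)` (i.e. `a[β] = b[β]` for every `β`),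
then `a = λ • b` for some nonzero scalar `λ`. -/
theorem MWS_eq_distribution_implies_proportional (q n k : ℕ) (hq : IsPrimePow q)
    (F : Type*) [Field F] [Fintype F] [DecidableEq F] (hcard : Fintype.card F = q)
    (C : Submodule F (Fin n → F)) (hdim : Module.finrank F C = k)
    (hMWS : (wtSet (C : Set (Fin n → F))).ncard = (q ^ k - 1) / (q - 1))
    (a b : Fin n → F) (ha : a ∈ C) (hb : b ∈ C) (ha0 : a ≠ 0) (hb0 : b ≠ 0)
    (hV : ∀ β : F, cnt a β = cnt b β) :
    ∃ lam : F, lam ≠ 0 ∧ a = lam • b := by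
  have hcardP : Nat.card (Projectivization F C) = (q ^ k - 1) / (q - 1) := by
    rw [Projectivization.card'', Module.natCard_eq_pow_finrank (K := F), hdim,
      Nat.card_eq_fintype_card, hcard]
  let f : Projectivization F C → wtSet (C : Set (Fin n → F)) := fun p =>
    ⟨wt (p.rep : Fin n → F), p.rep, p.rep.2, by simpa using p.rep_nonzero, rfl⟩
  have hsurj : Function.Surjective f := by
    rintro ⟨w, c, hc, hc0, rfl⟩
    have hc0' : (⟨c, hc⟩ : C) ≠ 0 := by simpa using hc0
    exact ⟨Projectivization.mk F ⟨c, hc⟩ hc0', Subtype.ext (wt_rep_mk _ hc0')⟩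
  have hinj : Function.Injective f := by
    refine (hsurj.bijective_of_nat_card_le ?_).injective
    rw [hcardP, ← hMWS, Nat.card_coe_set_eq]
  have hwt : wt a = wt b := by
    have h1 := cnt_zero_add_wt a
    have h2 := cnt_zero_add_wt b
    have h3 := hV 0
    omega
  have ha0' : (⟨a, ha⟩ : C) ≠ 0 := by simpa using ha0
  have hb0' : (⟨b, hb⟩ : C) ≠ 0 := by simpa using hb0
  have hab : Projectivization.mk F (⟨a, ha⟩ : C) ha0' =
      Projectivization.mk F (⟨b, hb⟩ : C) hb0' :=
    hinj (Subtype.ext ((wt_rep_mk _ ha0').trans (hwt.trans (wt_rep_mk _ hb0').symm)))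
  obtain ⟨u, hu⟩ := (Projectivization.mk_eq_mk_iff F _ _ ha0' hb0').1 hab
  exact ⟨u, u.ne_zero, (congrArg Subtype.val hu).symm⟩
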